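/- The lower value function V⁻ of the game Γ_{Ẽ,δ} is a super-solution on (s0,1)×Δ_δ(X×Z) of the Hamilton–Jacobi equation ω_t + ℋ⁻(t,μ,Dω) = 0, where ℋ⁻(t,μ,φ) = sup_{z∈Δ_δ(Z)} inf_{x∈Δ_δ(X)} (1/t)∫φ d(x⊗z − μ); that is, for every (t,μ) ∈ (s0,1)×Δ_δ(X×Z) and every (p,φ) ∈ D⁻V⁻(t,μ), one has p + ℋ⁻(t,μ,φ) ≤ 0. -/

import Mathlib

open MeasureTheory Set

noncomputable section

/-- Euclidean space `ℝ^n`. -/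
abbrev Euc (n : ℕ) := EuclideanSpace ℝ (Fin n)

/-- The squared Wasserstein distance
`W₂²(μ,ν) = inf_{γ ∈ Π(μ,ν)} ∫ ‖x−y‖² dγ(x,y)` (infimum over couplings). -/
def W2sq {Ω : Type*} [MeasurableSpace Ω] [NormedAddCommGroup Ω] (μ ν : Measure Ω) : ℝ :=
  sInf {c : ℝ | ∃ γ : Measure (Ω × Ω), IsProbabilityMeasure γ ∧
    γ.map Prod.fst = μ ∧ γ.map Prod.snd = ν ∧ c = ∫ p, ‖p.1 - p.2‖ ^ 2 ∂γ}

/-- The transform `φ*(x) = inf_{y ∈ K} ‖x − y‖² − φ(y)`. -/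
def cstar {Ω : Type*} [NormedAddCommGroup Ω] (K : Set Ω) (φ : Ω → ℝ) (x : Ω) : ℝ :=
  ⨅ y : K, (‖x - y.1‖ ^ 2 - φ y.1)

/-- The class `Ξ` of continuous functions `φ` on `K` with `φ(x*) = 0` and `φ = (φ*)*`. -/
def Xi {Ω : Type*} [NormedAddCommGroup Ω] (K : Set Ω) (xstar : Ω) : Set (Ω → ℝ) :=
  {φ | ContinuousOn φ K ∧ φ xstar = 0 ∧ ∀ x ∈ K, cstar K (cstar K φ) x = φ x}

/-- `φ` is a Kantorovich potential from `μ` to `ν`: `φ ∈ Ξ` and `∫φ dμ + ∫φ* dν = W₂²(μ,ν)`. -/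
def IsKantPotential {Ω : Type*} [MeasurableSpace Ω] [NormedAddCommGroup Ω]
    (K : Set Ω) (xstar : Ω) (μ ν : Measure Ω) (φ : Ω → ℝ) : Prop :=
  φ ∈ Xi K xstar ∧ (∫ x, φ x ∂μ) + (∫ x, cstar K φ x ∂ν) = W2sq μ ν

/-- The data of the sets `Δ_δ(X)`, `Δ_δ(Z)` and `Δ_δ(X×Z)`: convex compact sets of
probability measures with densities bounded below by a positive constant, `δ`-dense in
`Δ(X)` resp. `Δ(Z)`, and `Δ_δ(X×Z)` is the closed convex hull of the product measures. -/
structure DeltaSets (a b : ℕ) where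
  X : Set (Euc a)
  Z : Set (Euc b)
  hXc : IsCompact X
  hXconv : Convex ℝ X
  hXne : X.Nonempty
  hZc : IsCompact Z
  hZconv : Convex ℝ Z
  hZne : Z.Nonempty
  δ : ℝ
  hδ : 0 < δ
  DX : Set (Measure (Euc a))
  DZ : Set (Measure (Euc b))
  D : Set (Measure (Euc a × Euc b))
  hDXprob : ∀ μ ∈ DX, IsProbabilityMeasure μ
  hDXsupp : ∀ μ ∈ DX, μ Xᶜ = 0
  hDXconv : ∀ μ ∈ DX, ∀ ν ∈ DX, ∀ t ∈ Icc (0 : ℝ) 1,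
    ENNReal.ofReal t • μ + ENNReal.ofReal (1 - t) • ν ∈ DX
  hDXcomp : IsCompact {q : ProbabilityMeasure (Euc a) | (q : Measure (Euc a)) ∈ DX}
  hDXne : DX.Nonempty
  hDXdens : ∃ c : ENNReal, 0 < c ∧ ∀ μ ∈ DX, ∀ S : Set (Euc a), MeasurableSet S →
    c * volume (S ∩ X) ≤ μ S
  hDXapprox : ∀ μ : Measure (Euc a), IsProbabilityMeasure μ → μ Xᶜ = 0 →
    ∃ ν ∈ DX, W2sq ν μ ≤ δ ^ 2
  hDZprob : ∀ μ ∈ DZ, IsProbabilityMeasure μ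
  hDZsupp : ∀ μ ∈ DZ, μ Zᶜ = 0
  hDZconv : ∀ μ ∈ DZ, ∀ ν ∈ DZ, ∀ t ∈ Icc (0 : ℝ) 1,
    ENNReal.ofReal t • μ + ENNReal.ofReal (1 - t) • ν ∈ DZ
  hDZcomp : IsCompact {q : ProbabilityMeasure (Euc b) | (q : Measure (Euc b)) ∈ DZ}
  hDZne : DZ.Nonempty
  hDZdens : ∃ c : ENNReal, 0 < c ∧ ∀ μ ∈ DZ, ∀ S : Set (Euc b), MeasurableSet S →
    c * volume (S ∩ Z) ≤ μ S
  hDZapprox : ∀ μ : Measure (Euc b), IsProbabilityMeasure μ → μ Zᶜ = 0 →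
    ∃ ν ∈ DZ, W2sq ν μ ≤ δ ^ 2
  hDprob : ∀ θ ∈ D, IsProbabilityMeasure θ
  hDsupp : ∀ θ ∈ D, θ (X ×ˢ Z)ᶜ = 0
  hDconv : ∀ θ ∈ D, ∀ θ' ∈ D, ∀ t ∈ Icc (0 : ℝ) 1,
    ENNReal.ofReal t • θ + ENNReal.ofReal (1 - t) • θ' ∈ D
  hDcomp : IsCompact {q : ProbabilityMeasure (Euc a × Euc b) | (q : Measure (Euc a × Euc b)) ∈ D}
  hDprod : ∀ μ ∈ DX, ∀ ν ∈ DZ, μ.prod ν ∈ D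
  hDhull : ∀ C : Set (Measure (Euc a × Euc b)),
    (∀ μ ∈ DX, ∀ ν ∈ DZ, μ.prod ν ∈ C) →
    (∀ θ ∈ C, ∀ θ' ∈ C, ∀ t ∈ Icc (0 : ℝ) 1,
      ENNReal.ofReal t • θ + ENNReal.ofReal (1 - t) • θ' ∈ C) →
    IsClosed {q : ProbabilityMeasure (Euc a × Euc b) | (q : Measure (Euc a × Euc b)) ∈ C} →
    D ⊆ C

/-- Measurable measure-valued controls with values in `DD`. -/
def MControl {Ω : Type*} [MeasurableSpace Ω] (DD : Set (Measure Ω)) : Type _ :=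
  {x : ℝ → Measure Ω // Measurable x ∧ ∀ t, x t ∈ DD}

/-- `x` and `y` coincide almost everywhere on `[s0, t]`. -/
def AEEqOn {E : Type*} (s0 t : ℝ) (x y : ℝ → E) : Prop :=
  ∀ᵐ s ∂(volume.restrict (Icc s0 t)), x s = y s

/-- Nonanticipative with delay piecewise-constant (NADC) strategies for measure-valued
controls: the produced control is constant on each `[m/N,(m+1)/N)` and the strategy is
nonanticipative with delay `1/N`. -/
def IsNADCM {Ω₁ Ω₂ : Type*} [MeasurableSpace Ω₁] [MeasurableSpace Ω₂]
    {DZ : Set (Measure Ω₂)} {DX : Set (Measure Ω₁)}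
    (s0 : ℝ) (α : MControl DZ → MControl DX) : Prop :=
  ∃ N : ℕ, 0 < N ∧
    (∀ z : MControl DZ, ∀ k < N, ∃ c,
      ∀ s ∈ Ico ((k : ℝ) / N) ((k + 1 : ℝ) / N), (α z).1 s = c) ∧
    (∀ k < N, ∀ z z' : MControl DZ, AEEqOn s0 ((k : ℝ) / N) z.1 z'.1 →
      AEEqOn s0 ((k + 1 : ℝ) / N) (α z).1 (α z').1)

/-- The trajectory `θ(s) = (s0/s) θ0 + (1/s) ∫_{s0}^s x(t) ⊗ z(t) dt` in the space of
measures on `X × Z`. -/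
def mtraj {a b : ℕ} (s0 : ℝ) (θ0 : Measure (Euc a × Euc b))
    (x : ℝ → Measure (Euc a)) (z : ℝ → Measure (Euc b)) (s : ℝ) : Measure (Euc a × Euc b) :=
  ENNReal.ofReal (s0 / s) • θ0 +
    ENNReal.ofReal (1 / s) •
      Measure.bind (volume.restrict (Ioc s0 s)) (fun t => (x t).prod (z t))

/-- The squared Wasserstein distance from `θ` to the set `Et`:
`W₂²(θ,Ẽ) = inf_{q ∈ Ẽ} W₂²(θ,q)`. -/
def W2sqSet {Ω : Type*} [MeasurableSpace Ω] [NormedAddCommGroup Ω]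
    (θ : Measure Ω) (Et : Set (Measure Ω)) : ℝ :=
  ⨅ q : Et, W2sq θ q.1

/-- The upper value `V⁺(s0,θ0) = inf_α sup_z W₂²(θ^{s0,θ0,α(z),z}(1), Ẽ)`. -/
def WVplus {a b : ℕ} (DX : Set (Measure (Euc a))) (DZ : Set (Measure (Euc b)))
    (Et : Set (Measure (Euc a × Euc b))) (s0 : ℝ) (θ0 : Measure (Euc a × Euc b)) : ℝ :=
  ⨅ α : {α : MControl DZ → MControl DX // IsNADCM s0 α},
    ⨆ z : MControl DZ, W2sqSet (mtraj s0 θ0 (α.1 z).1 z.1 1) Et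

/-- The lower value `V⁻(s0,θ0) = sup_β inf_x W₂²(θ^{s0,θ0,x,β(x)}(1), Ẽ)`. -/
def WVminus {a b : ℕ} (DX : Set (Measure (Euc a))) (DZ : Set (Measure (Euc b)))
    (Et : Set (Measure (Euc a × Euc b))) (s0 : ℝ) (θ0 : Measure (Euc a × Euc b)) : ℝ :=
  ⨆ β : {β : MControl DX → MControl DZ // IsNADCM s0 β},
    ⨅ x : MControl DX, W2sqSet (mtraj s0 θ0 x.1 (β.1 x).1 1) Et

/-- The upper Hamiltonian `ℋ⁺(t,μ,φ) = inf_x sup_z (1/t) ∫ φ d(x⊗z − μ)`. -/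
def Hplus {a b : ℕ} (DX : Set (Measure (Euc a))) (DZ : Set (Measure (Euc b)))
    (t : ℝ) (μ : Measure (Euc a × Euc b)) (φ : Euc a × Euc b → ℝ) : ℝ :=
  ⨅ x : DX, ⨆ z : DZ, (1 / t) * ((∫ p, φ p ∂(x.1.prod z.1)) - ∫ p, φ p ∂μ)

/-- The lower Hamiltonian `ℋ⁻(t,μ,φ) = sup_z inf_x (1/t) ∫ φ d(x⊗z − μ)`. -/
def Hminus {a b : ℕ} (DX : Set (Measure (Euc a))) (DZ : Set (Measure (Euc b)))
    (t : ℝ) (μ : Measure (Euc a × Euc b)) (φ : Euc a × Euc b → ℝ) : ℝ :=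
  ⨆ z : DZ, ⨅ x : DX, (1 / t) * ((∫ p, φ p ∂(x.1.prod z.1)) - ∫ p, φ p ∂μ)

/-- `(p,φ)` belongs to the super-differential `D⁺ω(t̄,θ̄)`: the corresponding limsup as
`α → 0⁺`, `t → t̄`, uniformly over `θ ∈ D`, is nonpositive (ε–r formulation). -/
def InSuperDiff {Ω : Type*} [MeasurableSpace Ω] (s0 : ℝ) (D : Set (Measure Ω))
    (ω : ℝ → Measure Ω → ℝ) (tb : ℝ) (θb : Measure Ω) (p : ℝ) (φ : Ω → ℝ) : Prop :=
  ∀ ε > 0, ∃ r > 0, ∀ al ∈ Ioo (0 : ℝ) r, ∀ t ∈ Icc s0 1, |t - tb| < r → ∀ θ ∈ D,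
    ω t (ENNReal.ofReal (1 - al) • θb + ENNReal.ofReal al • θ) - ω tb θb
      - p * (t - tb) - al * ((∫ x, φ x ∂θ) - ∫ x, φ x ∂θb) ≤ ε * (al + |t - tb|)

/-- `(p,φ)` belongs to the sub-differential `D⁻ω(t̄,θ̄)`, i.e. `(−p,−φ) ∈ D⁺(−ω)(t̄,θ̄)`. -/
def InSubDiff {Ω : Type*} [MeasurableSpace Ω] (s0 : ℝ) (D : Set (Measure Ω))
    (ω : ℝ → Measure Ω → ℝ) (tb : ℝ) (θb : Measure Ω) (p : ℝ) (φ : Ω → ℝ) : Prop :=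
  InSuperDiff s0 D (fun t θ => -(ω t θ)) tb θb (-p) (fun x => -(φ x))

set_option linter.unusedSectionVars false

section Aux
open ProbabilityTheory

variable {Ω : Type*} [MeasurableSpace Ω] [NormedAddCommGroup Ω] [BorelSpace Ω]
  [SecondCountableTopology Ω] [StandardBorelSpace Ω]

/-- coupling with integrable quadratic cost at most `e` -/
def Cpl {Ω : Type*} [MeasurableSpace Ω] [NormedAddCommGroup Ω] (θ θ' : Measure Ω) (e : ℝ) : Prop :=
  ∃ π : Measure (Ω × Ω), IsProbabilityMeasure π ∧ π.map Prod.fst = θ ∧ π.map Prod.snd = θ' ∧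
    Integrable (fun p : Ω × Ω => ‖p.1 - p.2‖ ^ 2) π ∧ ∫ p, ‖p.1 - p.2‖ ^ 2 ∂π ≤ e

theorem W2sq_nonneg' {Ω : Type*} [MeasurableSpace Ω] [NormedAddCommGroup Ω] (μ ν : Measure Ω) :
    0 ≤ W2sq μ ν := by
  apply Real.sInf_nonneg
  rintro c ⟨γ, _, _, _, rfl⟩
  exact integral_nonneg fun p => by positivity

theorem W2sq_bdd {Ω : Type*} [MeasurableSpace Ω] [NormedAddCommGroup Ω] (μ ν : Measure Ω) :
    BddBelow {c : ℝ | ∃ γ : Measure (Ω × Ω), IsProbabilityMeasure γ ∧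
    γ.map Prod.fst = μ ∧ γ.map Prod.snd = ν ∧ c = ∫ p, ‖p.1 - p.2‖ ^ 2 ∂γ} := by
  refine ⟨0, ?_⟩
  rintro c ⟨γ, _, _, _, rfl⟩
  exact integral_nonneg fun p => by positivity

theorem W2sqSet_nonneg {Ω : Type*} [MeasurableSpace Ω] [NormedAddCommGroup Ω] (μ : Measure Ω)
    (E : Set (Measure Ω)) : 0 ≤ W2sqSet μ E :=
  Real.iInf_nonneg fun _ => W2sq_nonneg' _ _

theorem glue_aux (u v w : Ω) (l : ℝ) (hl : 0 < l) :
    ‖v - w‖ ^ 2 ≤ (1 + l) * ‖u - w‖ ^ 2 + (1 + 1 / l) * ‖u - v‖ ^ 2 := by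
  have h : ‖v - w‖ ≤ ‖u - w‖ + ‖u - v‖ := by
    have : v - w = (u - w) - (u - v) := by abel
    rw [this]; exact norm_sub_le _ _
  have h2 : ‖v - w‖ ^ 2 ≤ (‖u - w‖ + ‖u - v‖) ^ 2 := by gcongr
  set A := ‖u - w‖
  set B := ‖u - v‖
  have h3 : 0 ≤ (l * A - B) ^ 2 / l := by positivity
  have h4 : (l * A - B) ^ 2 / l = l * A ^ 2 - 2 * A * B + 1 / l * B ^ 2 := by
    field_simp; ring
  nlinarith

theorem glue_one (θ θ' q : Measure Ω) (e : ℝ) (he : Cpl θ θ' e) (l : ℝ) (hl : 0 < l) :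
    W2sq θ' q ≤ (1 + l) * W2sq θ q + (1 + 1 / l) * e := by
  obtain ⟨π, hπ, h1, h2, hint, hle⟩ := he
  have he0 : 0 ≤ e := le_trans (integral_nonneg fun p => by positivity) hle
  have hθ : IsProbabilityMeasure θ := h1 ▸ Measure.isProbabilityMeasure_map measurable_fst.aemeasurable
  have hθ' : IsProbabilityMeasure θ' := h2 ▸ Measure.isProbabilityMeasure_map measurable_snd.aemeasurable
  by_cases hq : IsProbabilityMeasure q
  swap
  · have : W2sq θ' q = 0 := by
      unfold W2sq
      rw [show {c : ℝ | ∃ γ : Measure (Ω × Ω), IsProbabilityMeasure γ ∧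
        γ.map Prod.fst = θ' ∧ γ.map Prod.snd = q ∧ c = ∫ p, ‖p.1 - p.2‖ ^ 2 ∂γ} = ∅ from ?_]
      · exact Real.sInf_empty
      · ext c
        simp only [mem_ofPred_eq, mem_empty_iff_false, iff_false]
        rintro ⟨γ, hγ, _, h, _⟩
        exact hq (h ▸ Measure.isProbabilityMeasure_map measurable_snd.aemeasurable)
    rw [this]
    have := W2sq_nonneg' θ q
    positivity
  have key : (W2sq θ' q - (1 + 1 / l) * e) / (1 + l) ≤ W2sq θ q := by
    apply le_csInf
    · exact ⟨_, θ.prod q, inferInstance, by simp [Measure.map_fst_prod], by simp [Measure.map_snd_prod], rfl⟩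
    rintro c ⟨γ, hγ, g1, g2, rfl⟩
    have : Nonempty Ω := ⟨0⟩
    set κ := π.condKernel
    have hd : π.fst ⊗ₘ κ = π := π.disintegrate κ
    set Γ : Measure ((Ω × Ω) × Ω) := γ ⊗ₘ (κ.comap Prod.fst measurable_fst) with hΓ
    have hG1 : Γ.map Prod.fst = γ := by
      have := Measure.fst_compProd γ (κ.comap Prod.fst measurable_fst)
      exact this
    have hmm : Measurable (fun r : (Ω × Ω) × Ω => (r.1.1, r.2)) := by fun_prop
    have hG2 : Γ.map (fun r => (r.1.1, r.2)) = π := by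
      conv_rhs => rw [← hd]
      ext S hS
      rw [Measure.map_apply hmm hS, hΓ, Measure.compProd_apply (hmm hS),
        Measure.compProd_apply hS, Measure.fst, h1, ← g1, lintegral_map _ measurable_fst]
      · rfl
      · exact Kernel.measurable_kernel_prodMk_left hS
    have hmm3 : Measurable (fun r : (Ω × Ω) × Ω => (r.2, r.1.2)) := by fun_prop
    have hmem : ∫ p, ‖p.1 - p.2‖ ^ 2 ∂(Γ.map (fun r => (r.2, r.1.2))) ∈
      {c : ℝ | ∃ γ : Measure (Ω × Ω), IsProbabilityMeasure γ ∧
        γ.map Prod.fst = θ' ∧ γ.map Prod.snd = q ∧ c = ∫ p, ‖p.1 - p.2‖ ^ 2 ∂γ} := by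
      refine ⟨_, Measure.isProbabilityMeasure_map hmm3.aemeasurable, ?_, ?_, rfl⟩
      · rw [Measure.map_map measurable_fst hmm3, ← h2, ← hG2, Measure.map_map measurable_snd hmm]
        rfl
      · rw [Measure.map_map measurable_snd hmm3, ← g2, ← hG1, Measure.map_map measurable_snd measurable_fst]
        rfl
    have hmc : Measurable (fun p : Ω × Ω => ‖p.1 - p.2‖ ^ 2) := by fun_prop
    have hle1 := csInf_le (W2sq_bdd θ' q) hmem
    change W2sq θ' q ≤ _ at hle1
    rw [integral_map hmm3.aemeasurable hmc.aestronglyMeasurable] at hle1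
    have i2 : Integrable (fun r : (Ω × Ω) × Ω => ‖r.1.1 - r.2‖ ^ 2) Γ := by
      rw [← hG2] at hint
      exact hint.comp_measurable hmm
    have e2 : ∫ r, ‖r.1.1 - r.2‖ ^ 2 ∂Γ ≤ e := by
      rw [← hG2, integral_map hmm.aemeasurable hmc.aestronglyMeasurable] at hle
      exact hle
    have e1 : ∫ p, ‖p.1 - p.2‖ ^ 2 ∂γ = ∫ r, ‖r.1.1 - r.1.2‖ ^ 2 ∂Γ := by
      rw [← hG1, integral_map measurable_fst.aemeasurable hmc.aestronglyMeasurable]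
    rw [e1, div_le_iff₀ (by positivity), sub_le_iff_le_add, mul_comm]
    refine hle1.trans ?_
    by_cases i1 : Integrable (fun r : (Ω × Ω) × Ω => ‖r.1.1 - r.1.2‖ ^ 2) Γ
    · calc ∫ r, ‖r.2 - r.1.2‖ ^ 2 ∂Γ ≤ ∫ r, ((1 + l) * ‖r.1.1 - r.1.2‖ ^ 2 + (1 + 1 / l) * ‖r.1.1 - r.2‖ ^ 2) ∂Γ := by
            apply integral_mono_of_nonneg
            · exact Filter.Eventually.of_forall fun r => by positivity
            · exact (i1.const_mul _).add (i2.const_mul _)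
            · exact Filter.Eventually.of_forall fun r => glue_aux _ _ _ l hl
        _ = (1 + l) * ∫ r, ‖r.1.1 - r.1.2‖ ^ 2 ∂Γ + (1 + 1 / l) * ∫ r, ‖r.1.1 - r.2‖ ^ 2 ∂Γ := by
            rw [integral_add (i1.const_mul _) (i2.const_mul _), integral_const_mul, integral_const_mul]
        _ ≤ _ := by gcongr
    · have i3 : ¬ Integrable (fun r : (Ω × Ω) × Ω => ‖r.2 - r.1.2‖ ^ 2) Γ := by
        intro i3
        apply i1
        refine Integrable.mono' ((i3.const_mul (1 + 1)).add (i2.const_mul (1 + 1 / 1))) ?_ ?_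
        · exact (by fun_prop : Measurable fun r : (Ω × Ω) × Ω => ‖r.1.1 - r.1.2‖ ^ 2).aestronglyMeasurable
        · refine Filter.Eventually.of_forall fun r => ?_
          have := glue_aux r.2 r.1.1 r.1.2 1 one_pos
          rw [Real.norm_of_nonneg (by positivity)]
          rw [norm_sub_rev r.2 r.1.1] at this
          exact this
      rw [integral_undef i3]
      have : 0 ≤ ∫ r, ‖r.1.1 - r.1.2‖ ^ 2 ∂Γ := integral_nonneg fun p => by positivity
      positivity
  rw [div_le_iff₀ (by positivity)] at key
  linarith

theorem glue_set (θ θ' : Measure Ω) (E : Set (Measure Ω)) (e : ℝ) (he : Cpl θ θ' e) (l : ℝ)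
    (hl : 0 < l) : W2sqSet θ' E ≤ (1 + l) * W2sqSet θ E + (1 + 1 / l) * e := by
  have he0 : 0 ≤ e := by
    obtain ⟨π, hπ, h1, h2, hint, hle⟩ := he
    exact le_trans (integral_nonneg fun p => by positivity) hle
  rcases isEmpty_or_nonempty E with hE | hE
  · unfold W2sqSet
    rw [Real.iInf_of_isEmpty, Real.iInf_of_isEmpty]
    positivity
  have key : (W2sqSet θ' E - (1 + 1 / l) * e) / (1 + l) ≤ W2sqSet θ E := by
    apply le_ciInf
    intro q
    have h1 : W2sqSet θ' E ≤ W2sq θ' q.1 :=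
      ciInf_le ⟨0, by rintro _ ⟨q, rfl⟩; exact W2sq_nonneg' _ _⟩ q
    have h2 := glue_one θ θ' q.1 e he l hl
    rw [div_le_iff₀ (by positivity)]
    linarith
  rw [div_le_iff₀ (by positivity)] at key
  linarith

theorem Cpl.symm {θ θ' : Measure Ω} {e : ℝ} (h : Cpl θ θ' e) : Cpl θ' θ e := by
  obtain ⟨π, hπ, h1, h2, hint, hle⟩ := h
  have hmc : Measurable (fun p : Ω × Ω => ‖p.1 - p.2‖ ^ 2) := by fun_prop
  refine ⟨π.map Prod.swap, Measure.isProbabilityMeasure_map measurable_swap.aemeasurable, ?_, ?_, ?_, ?_⟩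
  · rw [Measure.map_map measurable_fst measurable_swap, ← h2]; rfl
  · rw [Measure.map_map measurable_snd measurable_swap, ← h1]; rfl
  · rw [integrable_map_measure hmc.aestronglyMeasurable measurable_swap.aemeasurable]
    refine hint.congr (Filter.Eventually.of_forall fun p => ?_)
    simp [norm_sub_rev]
  · rw [integral_map measurable_swap.aemeasurable hmc.aestronglyMeasurable]
    simpa [norm_sub_rev] using hle

theorem Cpl.mix {θ θ' ν : Measure Ω} {e : ℝ} (h : Cpl θ θ' e) (c : ℝ) (hc0 : 0 ≤ c) (hc1 : c ≤ 1)
    (hν : ν univ = ENNReal.ofReal (1 - c)) :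
    Cpl (ENNReal.ofReal c • θ + ν) (ENNReal.ofReal c • θ' + ν) e := by
  obtain ⟨π, hπ, h1, h2, hint, hle⟩ := h
  have hνf : IsFiniteMeasure ν := ⟨by rw [hν]; exact ENNReal.ofReal_lt_top⟩
  have hmc : Measurable (fun p : Ω × Ω => ‖p.1 - p.2‖ ^ 2) := by fun_prop
  have hdm : Measurable (fun x : Ω => (x, x)) := by fun_prop
  have he0 : 0 ≤ e := le_trans (integral_nonneg fun p => by positivity) hle
  have i1 : Integrable (fun p : Ω × Ω => ‖p.1 - p.2‖ ^ 2) (ENNReal.ofReal c • π) :=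
    hint.smul_measure ENNReal.ofReal_ne_top
  have i2 : Integrable (fun p : Ω × Ω => ‖p.1 - p.2‖ ^ 2) (ν.map fun x => (x, x)) := by
    rw [integrable_map_measure hmc.aestronglyMeasurable hdm.aemeasurable]
    simp [Function.comp_def]
  refine ⟨ENNReal.ofReal c • π + ν.map (fun x => (x, x)), ⟨?_⟩, ?_, ?_, i1.add_measure i2, ?_⟩
  · simp only [Measure.coe_add, Measure.coe_smul, Pi.add_apply, Pi.smul_apply, measure_univ,
      Measure.map_apply hdm MeasurableSet.univ, preimage_univ, hν, smul_eq_mul, mul_one]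
    rw [← ENNReal.ofReal_add hc0 (by linarith)]; simp
  · rw [Measure.map_add _ _ measurable_fst, Measure.map_smul, h1, Measure.map_map measurable_fst hdm]
    simp [Function.comp_def]
  · rw [Measure.map_add _ _ measurable_snd, Measure.map_smul, h2, Measure.map_map measurable_snd hdm]
    simp [Function.comp_def]
  · rw [integral_add_measure i1 i2, integral_smul_measure,
      integral_map hdm.aemeasurable hmc.aestronglyMeasurable]
    simp only [sub_self, norm_zero, ENNReal.toReal_ofReal hc0, smul_eq_mul]
    have : 0 ≤ ∫ p, ‖p.1 - p.2‖ ^ 2 ∂π := integral_nonneg fun p => by positivity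
    simp
    nlinarith

theorem simple_approx (K : Set Ω) (hK : IsCompact K) (hne : K.Nonempty) (η : ℝ) (hη : 0 < η) :
    ∃ f : SimpleFunc Ω Ω, (∀ x, f x ∈ K) ∧ ∀ x ∈ K, ‖x - f x‖ ≤ η := by
  obtain ⟨t, htK, htf, hcov⟩ := hK.finite_cover_balls hη
  have htne : t.Nonempty := by
    obtain ⟨x, hx⟩ := hne
    have := hcov hx
    simp only [mem_iUnion] at this
    obtain ⟨y, hy, _⟩ := this
    exact ⟨y, hy⟩
  obtain ⟨s, rfl⟩ := htf.countable.exists_eq_range htne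
  obtain ⟨N, hN⟩ : ∃ N : ℕ, ∀ y ∈ range s, ∃ k ≤ N, s k = y := by
    choose! g hg using fun (y : Ω) (hy : y ∈ range s) => hy
    obtain ⟨N, hN⟩ := (htf.image g).bddAbove
    exact ⟨N, fun y hy => ⟨g y, hN ⟨y, hy, rfl⟩, hg y hy⟩⟩
  refine ⟨SimpleFunc.nearestPt s N, fun x => htK ⟨_, rfl⟩, fun x hx => ?_⟩
  have := hcov hx
  simp only [mem_iUnion] at this
  obtain ⟨y, hy, hxy⟩ := this
  obtain ⟨k, hk, rfl⟩ := hN y hy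
  have h1 := SimpleFunc.edist_nearestPt_le s x hk
  rw [edist_dist, edist_dist, ENNReal.ofReal_le_ofReal_iff dist_nonneg] at h1
  rw [← dist_eq_norm, dist_comm]
  refine h1.trans ?_
  rw [dist_comm]
  exact (Metric.mem_ball.1 hxy).le

theorem net (K : Set Ω) (hK : IsCompact K) (hne : K.Nonempty) (e : ℝ) (he : 0 < e) :
    ∃ S : Set (Measure Ω), S.Finite ∧ ∀ θ : Measure Ω, IsProbabilityMeasure θ → θ Kᶜ = 0 →
      ∃ ρ ∈ S, Cpl θ ρ e := by
  obtain ⟨R, hR⟩ : ∃ R : ℝ, ∀ x ∈ K, ∀ y ∈ K, ‖x - y‖ ^ 2 ≤ R := by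
    obtain ⟨C, hC⟩ := Metric.isBounded_iff.1 hK.isBounded
    refine ⟨C ^ 2, fun x hx y hy => ?_⟩
    have := hC hx hy
    rw [dist_eq_norm] at this
    gcongr
  have hR0 : 0 ≤ R := by
    obtain ⟨x, hx⟩ := hne
    simpa using hR x hx x hx
  obtain ⟨f, hfK, hf⟩ := simple_approx K hK hne (Real.sqrt (e / 2)) (Real.sqrt_pos.2 (by positivity))
  have hf2 : ∀ x ∈ K, ‖x - f x‖ ^ 2 ≤ e / 2 := fun x hx => by
    have := hf x hx
    calc _ ≤ (Real.sqrt (e / 2)) ^ 2 := by gcongr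
      _ = _ := Real.sq_sqrt (by positivity)
  obtain ⟨p0, hp0⟩ := hne
  set T := f.range with hT
  obtain ⟨n, hn⟩ := exists_nat_gt (2 * (T.card * R) / e)
  have hn0 : (0 : ℝ) < n := lt_of_le_of_lt (by positivity) hn
  have hnR : T.card * (R / n) ≤ e / 2 := by
    rw [div_lt_iff₀ he] at hn
    rw [← mul_div_assoc, div_le_iff₀ hn0]
    linarith
  refine ⟨range fun j : T → Fin (n + 1) => (∑ p : T, ENNReal.ofReal ((j p : ℕ) / n : ℝ) • Measure.dirac p.1) +
    (1 - ∑ p : T, ENNReal.ofReal ((j p : ℕ) / n : ℝ)) • Measure.dirac p0, finite_range _, ?_⟩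
  intro θ hθ hθK
  have hθK' : ∀ᵐ x ∂θ, x ∈ K := by
    rw [ae_iff]; exact hθK
  set v : T → ℝ := fun p => θ.real (f ⁻¹' {p.1}) with hv
  have hv0 : ∀ p, 0 ≤ v p := fun p => measureReal_nonneg
  have hv1 : ∀ p, v p ≤ 1 := fun p => measureReal_le_one
  have hmv : ∀ p : T, θ (f ⁻¹' {p.1}) = ENNReal.ofReal (v p) := fun p => by
    simp [hv, Measure.real]
  set jj : T → ℕ := fun p => ⌊n * v p⌋₊ with hjj
  have hjle : ∀ p, (jj p : ℝ) ≤ n * v p := fun p => Nat.floor_le (mul_nonneg hn0.le (hv0 p))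
  have hjge : ∀ p, n * v p < jj p + 1 := fun p => Nat.lt_floor_add_one _
  have hjn : ∀ p, jj p < n + 1 := fun p => by
    have h1 := hjle p
    have h2 := hv1 p
    have : (jj p : ℝ) ≤ n := by nlinarith
    have : jj p ≤ n := by exact_mod_cast this
    omega
  set A : T → ℝ := fun p => jj p / n with hA
  set B : T → ℝ := fun p => v p - A p with hB
  have hA0 : ∀ p, 0 ≤ A p := fun p => by positivity
  have hAv : ∀ p, A p ≤ v p := fun p => by
    rw [hA]; simp only; rw [div_le_iff₀ hn0]; linarith [hjle p]
  have hB0 : ∀ p, 0 ≤ B p := fun p => sub_nonneg.2 (hAv p)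
  have hBn : ∀ p, B p ≤ 1 / n := fun p => by
    have := hjge p
    simp only [hB, hA]
    rw [sub_le_iff_le_add, ← add_div, le_div_iff₀ hn0]; linarith
  set m : T → Measure Ω := fun p => θ.restrict (f ⁻¹' {p.1}) with hm
  have hmu : ∀ p, m p univ = ENNReal.ofReal (v p) := fun p => by
    simp [hm, hmv]
  have hm0 : ∀ p, v p = 0 → m p = 0 := fun p hp => by
    rw [← Measure.measure_univ_eq_zero, hmu, hp, ENNReal.ofReal_zero]
  have hsum : ∑ p, m p = θ := by
    rw [← Measure.sum_fintype, ← Measure.restrict_iUnion]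
    · rw [show (⋃ p : T, f ⁻¹' {p.1}) = univ from ?_, Measure.restrict_univ]
      ext x
      simp [hT]
    · intro p q hpq
      refine Disjoint.preimage _ ?_
      simpa using fun h => hpq (Subtype.ext h)
    · exact fun p => f.measurableSet_fiber _
  set c1 : T → ENNReal := fun p => ENNReal.ofReal (A p / v p) with hc1
  set c2 : T → ENNReal := fun p => ENNReal.ofReal (B p / v p) with hc2
  have hm1 : ∀ p : Ω, Measurable fun x : Ω => (x, p) := fun p => by fun_prop
  set π : Measure (Ω × Ω) := ∑ p : T, (c1 p • (m p).map (fun x => (x, p.1)) +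
    c2 p • (m p).map (fun x => (x, p0))) with hπ
  have hfst : π.map Prod.fst = θ := by
    rw [hπ, Measure.map_finset_sum measurable_fst.aemeasurable]
    conv_rhs => rw [← hsum]
    refine Finset.sum_congr rfl fun p _ => ?_
    rw [Measure.map_add _ _ measurable_fst, Measure.map_smul, Measure.map_smul,
      Measure.map_map measurable_fst (hm1 _), Measure.map_map measurable_fst (hm1 _)]
    simp only [Function.comp_def, Measure.map_id']
    rcases eq_or_ne (v p) 0 with h | h
    · rw [hm0 p h]; simp
    · rw [← add_smul, hc1, hc2]
      simp only
      rw [← ENNReal.ofReal_add (div_nonneg (hA0 p) (hv0 p)) (div_nonneg (hB0 p) (hv0 p)), ← add_div]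
      simp [hB, h]
  have hprob : IsProbabilityMeasure π := ⟨by
    have : π.map Prod.fst univ = 1 := by rw [hfst]; simp
    rwa [Measure.map_apply measurable_fst MeasurableSet.univ] at this⟩
  have hmul : ∀ p (r : ℝ), 0 ≤ r → (v p = 0 → r = 0) → ENNReal.ofReal (r / v p) * m p univ = ENNReal.ofReal r := by
    intro p r hr h0
    rw [hmu, ← ENNReal.ofReal_mul (div_nonneg hr (hv0 p))]
    rcases eq_or_ne (v p) 0 with h | h
    · simp [h0 h]
    · rw [div_mul_cancel₀ _ h]
  have hsnd : π.map Prod.snd = (∑ p : T, ENNReal.ofReal (A p) • Measure.dirac p.1) +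
      (∑ p : T, ENNReal.ofReal (B p)) • Measure.dirac p0 := by
    rw [hπ, Measure.map_finset_sum measurable_snd.aemeasurable, Finset.sum_smul, ← Finset.sum_add_distrib]
    refine Finset.sum_congr rfl fun p _ => ?_
    rw [Measure.map_add _ _ measurable_snd, Measure.map_smul, Measure.map_smul,
      Measure.map_map measurable_snd (hm1 _), Measure.map_map measurable_snd (hm1 _)]
    simp only [Function.comp_def, Measure.map_const, smul_smul, hc1, hc2]
    rw [hmul p (A p) (hA0 p) (fun h => le_antisymm (h ▸ hAv p) (hA0 p)), hmul p (B p) (hB0 p)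
      (fun h => by have := hAv p; have := hA0 p; simp only [hB]; linarith)]
  have hAB : (∑ p : T, ENNReal.ofReal (A p)) + ∑ p : T, ENNReal.ofReal (B p) = 1 := by
    have : π.map Prod.snd univ = 1 := by
      rw [Measure.map_apply measurable_snd MeasurableSet.univ]; simp
    rw [hsnd] at this
    simpa using this
  refine ⟨_, ⟨fun p => ⟨jj p, hjn p⟩, rfl⟩, π, hprob, hfst, ?_, ?_⟩
  · rw [hsnd]
    simp only
    congr 2
    refine ENNReal.eq_sub_of_add_eq ?_ ?_
    · exact (ENNReal.sum_lt_top.2 fun p _ => ENNReal.ofReal_lt_top).ne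
    · rw [add_comm]; exact hAB
  have hmc : Measurable (fun p : Ω × Ω => ‖p.1 - p.2‖ ^ 2) := by fun_prop
  have hmK : ∀ p, ∀ᵐ x ∂(m p), x ∈ K := fun p => ae_restrict_of_ae hθK'
  have hmf : ∀ p : T, ∀ᵐ x ∂(m p), f x = p.1 := fun p => by
    filter_upwards [ae_restrict_mem (f.measurableSet_fiber p.1)] with x hx using hx
  have hint : ∀ p, ∀ q ∈ K, Integrable (fun p : Ω × Ω => ‖p.1 - p.2‖ ^ 2) ((m p).map (fun x => (x, q))) := by
    intro p q hq
    rw [integrable_map_measure hmc.aestronglyMeasurable (hm1 q).aemeasurable]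
    refine Integrable.of_bound (hmc.comp (hm1 q)).aestronglyMeasurable R ?_
    filter_upwards [hmK p] with x hx
    simp only [Function.comp]
    rw [Real.norm_of_nonneg (by positivity)]
    exact hR x hx q hq
  have hcost : ∀ p, ∀ q ∈ K, ∀ D : ℝ, (∀ᵐ x ∂(m p), ‖x - q‖ ^ 2 ≤ D) →
      ∫ r, ‖r.1 - r.2‖ ^ 2 ∂((m p).map (fun x => (x, q))) ≤ D * v p := by
    intro p q hq D hD
    have := hint p q hq
    rw [integrable_map_measure hmc.aestronglyMeasurable (hm1 q).aemeasurable] at this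
    rw [integral_map (hm1 q).aemeasurable hmc.aestronglyMeasurable]
    have h2 := integral_mono_ae this (integrable_const D) hD
    simp only [integral_const, smul_eq_mul, Measure.real, hmu, ENNReal.toReal_ofReal (hv0 p)] at h2
    rw [mul_comm D]
    exact h2
  have hpK : ∀ p : T, p.1 ∈ K := fun p => by
    obtain ⟨x, hx⟩ := SimpleFunc.mem_range.1 p.2
    rw [← hx]; exact hfK x
  have hi1 : ∀ p : T, Integrable (fun p : Ω × Ω => ‖p.1 - p.2‖ ^ 2) (c1 p • (m p).map (fun x => (x, p.1))) :=
    fun p => (hint p _ (hpK p)).smul_measure ENNReal.ofReal_ne_top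
  have hi2 : ∀ p : T, Integrable (fun p : Ω × Ω => ‖p.1 - p.2‖ ^ 2) (c2 p • (m p).map (fun x => (x, p0))) :=
    fun p => (hint p _ hp0).smul_measure ENNReal.ofReal_ne_top
  refine ⟨integrable_finsetSum_measure.2 fun p _ => (hi1 p).add_measure (hi2 p), ?_⟩
  rw [hπ, integral_finsetSum_measure fun p _ => (hi1 p).add_measure (hi2 p)]
  have hvs : ∑ p, v p = 1 := by
    have : (∑ p, m p) univ = 1 := by rw [hsum]; simp
    simp only [Measure.coe_finsetSum, Finset.sum_apply, hmu] at this
    rw [← ENNReal.ofReal_sum_of_nonneg fun p _ => hv0 p] at this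
    simpa using this
  calc _ ≤ ∑ p : T, (e / 2 * v p + R / n) := by
        refine Finset.sum_le_sum fun p _ => ?_
        rw [integral_add_measure (hi1 p) (hi2 p), integral_smul_measure, integral_smul_measure]
        have k1 := hcost p p.1 (hpK p) (e / 2) (by
          filter_upwards [hmK p, hmf p] with x hx hx2
          rw [← hx2]; exact hf2 x hx)
        have k2 := hcost p p0 hp0 R (by
          filter_upwards [hmK p] with x hx
          exact hR x hx p0 hp0)
        simp only [hc1, hc2, smul_eq_mul]
        rw [ENNReal.toReal_ofReal (div_nonneg (hA0 p) (hv0 p)), ENNReal.toReal_ofReal (div_nonneg (hB0 p) (hv0 p))]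
        have hx1 : A p / v p ≤ 1 := div_le_one_of_le₀ (hAv p) (hv0 p)
        have y1 : A p / v p * ∫ r, ‖r.1 - r.2‖ ^ 2 ∂((m p).map (fun x => (x, p.1))) ≤ e / 2 * v p := by
          have := mul_le_mul_of_nonneg_left k1 (div_nonneg (hA0 p) (hv0 p))
          have h3 : 0 ≤ e / 2 * v p := mul_nonneg (by positivity) (hv0 p)
          nlinarith
        have y2 : B p / v p * ∫ r, ‖r.1 - r.2‖ ^ 2 ∂((m p).map (fun x => (x, p0))) ≤ R / n := by
          have h4 := mul_le_mul_of_nonneg_left k2 (div_nonneg (hB0 p) (hv0 p))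
          refine h4.trans ?_
          have h5 : B p / v p * (R * v p) ≤ R * B p := by
            rcases eq_or_ne (v p) 0 with h | h
            · rw [h]; simp; exact mul_nonneg hR0 (hB0 p)
            · field_simp; exact le_refl _
          refine h5.trans ?_
          have := mul_le_mul_of_nonneg_left (hBn p) hR0
          rwa [mul_one_div] at this
        exact add_le_add y1 y2
    _ = e / 2 + T.card * (R / n) := by
        rw [Finset.sum_add_distrib, ← Finset.mul_sum, hvs]
        simp
    _ ≤ e := by linarith

theorem cpl_prod (K : Set Ω) (R : ℝ) (hR : ∀ x ∈ K, ∀ y ∈ K, ‖x - y‖ ^ 2 ≤ R)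
    (θ θ' : Measure Ω) [IsProbabilityMeasure θ] [IsProbabilityMeasure θ'] (h : θ Kᶜ = 0) (h' : θ' Kᶜ = 0) :
    Cpl θ θ' R := by
  have hmc : Measurable (fun p : Ω × Ω => ‖p.1 - p.2‖ ^ 2) := by fun_prop
  have h1 : ∀ᵐ r ∂(θ.prod θ'), r.1 ∈ K := by
    have : ∀ᵐ x ∂θ, x ∈ K := by rw [ae_iff]; exact h
    exact Measure.quasiMeasurePreserving_fst.ae this
  have h2 : ∀ᵐ r ∂(θ.prod θ'), r.2 ∈ K := by
    have : ∀ᵐ x ∂θ', x ∈ K := by rw [ae_iff]; exact h'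
    exact Measure.quasiMeasurePreserving_snd.ae this
  have hi : Integrable (fun p : Ω × Ω => ‖p.1 - p.2‖ ^ 2) (θ.prod θ') := by
    refine Integrable.of_bound hmc.aestronglyMeasurable R ?_
    filter_upwards [h1, h2] with r hr1 hr2
    rw [Real.norm_of_nonneg (by positivity)]
    exact hR _ hr1 _ hr2
  refine ⟨θ.prod θ', inferInstance, by simp [Measure.map_fst_prod], by simp [Measure.map_snd_prod], hi, ?_⟩
  have := integral_mono_ae hi (integrable_const R) (by
    filter_upwards [h1, h2] with r hr1 hr2
    exact hR _ hr1 _ hr2)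
  simpa using this

theorem bind_prob {ν : Measure ℝ} [IsProbabilityMeasure ν] {y : ℝ → Measure Ω} (hy : Measurable y)
    (hp : ∀ s, IsProbabilityMeasure (y s)) : IsProbabilityMeasure (ν.bind y) := ⟨by
  rw [Measure.bind_apply MeasurableSet.univ hy.aemeasurable]; simp⟩

theorem integral_bind_bdd {ν : Measure ℝ} [IsProbabilityMeasure ν] {y : ℝ → Measure Ω} (hy : Measurable y)
    (hp : ∀ s, IsProbabilityMeasure (y s)) (f : Ω → ℝ) (hf : Measurable f) (B : ℝ) (hB : ∀ w, ‖f w‖ ≤ B) :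
    Integrable (fun s => ∫ w, f w ∂(y s)) ν ∧ ∫ w, f w ∂(ν.bind y) = ∫ s, ∫ w, f w ∂(y s) ∂ν := by
  let κ : Kernel ℝ Ω := ⟨y, hy⟩
  haveI := bind_prob hy hp (ν := ν)
  have hi : Integrable f ((κ ∘ₖ Kernel.const Unit ν) ()) := by
    rw [Kernel.comp_apply]
    change Integrable f (ν.bind y)
    exact Integrable.of_bound hf.aestronglyMeasurable B (Filter.Eventually.of_forall hB)
  have h1 := hi.integral_comp
  have h2 := Kernel.integral_comp hi
  rw [Kernel.comp_apply] at h2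
  exact ⟨h1, h2⟩

theorem bary (S : Set (Measure Ω)) (hp : ∀ μ ∈ S, IsProbabilityMeasure μ)
    (hconv : ∀ μ ∈ S, ∀ ν ∈ S, ∀ t ∈ Icc (0 : ℝ) 1,
      ENNReal.ofReal t • μ + ENNReal.ofReal (1 - t) • ν ∈ S)
    (hcomp : IsCompact {q : ProbabilityMeasure Ω | (q : Measure Ω) ∈ S})
    (ν : Measure ℝ) [IsProbabilityMeasure ν] (y : ℝ → Measure Ω) (hy : Measurable y)
    (hyS : ∀ s, y s ∈ S) : ν.bind y ∈ S := by
  have hyp : ∀ s, IsProbabilityMeasure (y s) := fun s => hp _ (hyS s)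
  haveI hbp := bind_prob hy hyp (ν := ν)
  have key := hcomp.inter_iInter_nonempty
    (fun f : BoundedContinuousFunction Ω ℝ => {q : ProbabilityMeasure Ω | ∫ w, f w ∂(q : Measure Ω) = ∫ w, f w ∂(ν.bind y)})
    (fun f => isClosed_eq (ProbabilityMeasure.continuous_integral_boundedContinuousFunction f) continuous_const)
    (by
      intro u
      let Φ : ProbabilityMeasure Ω → (u → ℝ) := fun q f => ∫ w, f.1 w ∂(q : Measure Ω)
      have hΦ : Continuous Φ := continuous_pi fun f =>
        ProbabilityMeasure.continuous_integral_boundedContinuousFunction f.1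
      have hcl : IsClosed (Φ '' {q : ProbabilityMeasure Ω | (q : Measure Ω) ∈ S}) :=
        (hcomp.image hΦ).isClosed
      have hcv : Convex ℝ (Φ '' {q : ProbabilityMeasure Ω | (q : Measure Ω) ∈ S}) := by
        rintro _ ⟨q1, h1, rfl⟩ _ ⟨q2, h2, rfl⟩ a b ha hb hab
        have hm := hconv _ h1 _ h2 a ⟨ha, by linarith⟩
        refine ⟨⟨_, hp _ hm⟩, hm, ?_⟩
        ext f
        have hb' : 1 - a = b := by linarith
        have i1 : ∀ q : ProbabilityMeasure Ω, Integrable (fun w => f.1 w) (q : Measure Ω) :=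
          fun q => f.1.integrable _
        simp only [Φ, ProbabilityMeasure.coe_mk, Pi.add_apply, Pi.smul_apply, smul_eq_mul]
        rw [integral_add_measure ((i1 q1).smul_measure ENNReal.ofReal_ne_top)
          ((i1 q2).smul_measure ENNReal.ofReal_ne_top), integral_smul_measure, integral_smul_measure,
          hb', ENNReal.toReal_ofReal ha, ENNReal.toReal_ofReal hb]
        rfl
      have hib : ∀ f : u, Integrable (fun s => ∫ w, f.1 w ∂(y s)) ν ∧ ∫ w, f.1 w ∂(ν.bind y) = ∫ s, ∫ w, f.1 w ∂(y s) ∂ν :=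
        fun f => integral_bind_bdd hy hyp _ f.1.continuous.measurable ‖f.1‖ f.1.norm_coe_le_norm
      have hmem := hcv.integral_mem (μ := ν) (f := fun s (f : u) => ∫ w, f.1 w ∂(y s)) hcl
        (Filter.Eventually.of_forall fun s => ⟨⟨y s, hyp s⟩, hyS s, rfl⟩)
        (Integrable.of_eval fun f => (hib f).1)
      obtain ⟨q, hq, hqe⟩ := hmem
      refine ⟨q, hq, ?_⟩
      simp only [mem_iInter]
      intro f hf
      have h3 := congrFun hqe ⟨f, hf⟩
      rw [eval_integral fun f => (hib f).1] at h3
      change ∫ w, f w ∂(q : Measure Ω) = ∫ w, f w ∂(ν.bind y)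
      rw [(hib ⟨f, hf⟩).2]
      exact h3)
  obtain ⟨q, hq, hqe⟩ := key
  have : (q : Measure Ω) = ν.bind y := by
    apply ext_of_forall_integral_eq_of_IsFiniteMeasure
    intro f
    exact mem_iInter.1 hqe f
  rw [← this]; exact hq

end Aux

section Game
open ProbabilityTheory

theorem meas_prod {a b : ℕ} {x : ℝ → Measure (Euc a)} {z : ℝ → Measure (Euc b)} (hx : Measurable x)
    (hz : Measurable z) (hxp : ∀ s, IsProbabilityMeasure (x s)) (hzp : ∀ s, IsProbabilityMeasure (z s)) :
    Measurable fun s => (x s).prod (z s) := by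
  let κ : Kernel ℝ (Euc a) := ⟨x, hx⟩
  let η : Kernel ℝ (Euc b) := ⟨z, hz⟩
  haveI : IsMarkovKernel κ := ⟨hxp⟩
  haveI : IsMarkovKernel η := ⟨hzp⟩
  have : (fun s => (x s).prod (z s)) = fun s => (κ ×ₖ η) s := by
    ext1 s
    rw [Kernel.prod_apply]; rfl
  rw [this]
  exact (κ ×ₖ η).measurable

theorem bind_add_left {Ω : Type*} [MeasurableSpace Ω] (m1 m2 : Measure ℝ) {y : ℝ → Measure Ω}
    (hy : Measurable y) : (m1 + m2).bind y = m1.bind y + m2.bind y := by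
  ext s hs
  simp [Measure.bind_apply hs hy.aemeasurable, lintegral_add_measure]

variable {a b : ℕ} (G : DeltaSets a b)

theorem xp (x : MControl G.DX) : ∀ s, IsProbabilityMeasure (x.1 s) := fun s => G.hDXprob _ (x.2.2 s)
theorem zp (z : MControl G.DZ) : ∀ s, IsProbabilityMeasure (z.1 s) := fun s => G.hDZprob _ (z.2.2 s)

theorem mp (x : MControl G.DX) (z : MControl G.DZ) : Measurable fun s => (x.1 s).prod (z.1 s) :=
  meas_prod x.2.1 z.2.1 (xp G x) (zp G z)

theorem pp (x : MControl G.DX) (z : MControl G.DZ) : ∀ s, IsProbabilityMeasure ((x.1 s).prod (z.1 s)) := by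
  intro s
  haveI := xp G x s
  haveI := zp G z s
  infer_instance

/-- normalized Lebesgue measure -/
def nleb (t τ : ℝ) : Measure ℝ := ENNReal.ofReal (1 / (τ - t)) • volume.restrict (Ioc t τ)

theorem nleb_prob {t τ : ℝ} (h : t < τ) : IsProbabilityMeasure (nleb t τ) := ⟨by
  have : 0 < τ - t := by linarith
  simp only [nleb, Measure.coe_smul, Pi.smul_apply, Measure.restrict_apply MeasurableSet.univ,
    univ_inter, Real.volume_Ioc, smul_eq_mul]
  rw [← ENNReal.ofReal_mul (by positivity)]
  rw [one_div, inv_mul_cancel₀ this.ne', ENNReal.ofReal_one]⟩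

theorem mtraj_eq {t τ : ℝ} (ht : 0 < t) (h : t < τ) (μ : Measure (Euc a × Euc b)) (x : ℝ → Measure (Euc a))
    (z : ℝ → Measure (Euc b)) :
    mtraj t μ x z τ = ENNReal.ofReal (1 - (τ - t) / τ) • μ +
      ENNReal.ofReal ((τ - t) / τ) • (nleb t τ).bind (fun s => (x s).prod (z s)) := by
  have h1 : 0 < τ - t := by linarith
  have h2 : 0 < τ := by linarith
  unfold mtraj nleb
  rw [Measure.bind_smul, smul_smul, ← ENNReal.ofReal_mul (by positivity)]
  congr 3
  · field_simp; ring_nf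
  · field_simp

theorem avg_mem {t τ : ℝ} (h : t < τ) (x : MControl G.DX) (z : MControl G.DZ) :
    (nleb t τ).bind (fun s => (x.1 s).prod (z.1 s)) ∈ G.D := by
  haveI := nleb_prob h
  exact bary G.D G.hDprob G.hDconv G.hDcomp _ _ (mp G x z) fun s => G.hDprod _ (x.2.2 s) _ (z.2.2 s)

theorem traj_mem {t τ : ℝ} (ht : 0 < t) (h : t < τ) {μ : Measure (Euc a × Euc b)} (hμ : μ ∈ G.D)
    (x : MControl G.DX) (z : MControl G.DZ) : mtraj t μ x.1 z.1 τ ∈ G.D := by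
  rw [mtraj_eq ht h]
  have h1 : 0 < τ - t := by linarith
  have h2 : 0 < τ := by linarith
  have := G.hDconv μ hμ _ (avg_mem G h x z) (1 - (τ - t) / τ)
    ⟨by rw [sub_nonneg, div_le_one h2]; linarith, by simp; positivity⟩
  rwa [sub_sub_cancel] at this

theorem K_compact : IsCompact (G.X ×ˢ G.Z) := G.hXc.prod G.hZc

theorem F_bdd (Et : Set (Measure (Euc a × Euc b))) : ∃ C : ℝ, 0 ≤ C ∧ ∀ θ ∈ G.D, W2sqSet θ Et ≤ C := by
  obtain ⟨x0, hx0⟩ := G.hDXne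
  obtain ⟨z0, hz0⟩ := G.hDZne
  have h0 := G.hDprod _ hx0 _ hz0
  obtain ⟨C, hC⟩ := Metric.isBounded_iff.1 (K_compact G).isBounded
  have hR : ∀ x ∈ G.X ×ˢ G.Z, ∀ y ∈ G.X ×ˢ G.Z, ‖x - y‖ ^ 2 ≤ C ^ 2 := by
    intro x hx y hy
    have := hC hx hy
    rw [dist_eq_norm] at this
    gcongr
  have hn := W2sqSet_nonneg (x0.prod z0) Et
  refine ⟨(1 + 1) * W2sqSet (x0.prod z0) Et + (1 + 1 / 1) * C ^ 2, by positivity, fun θ hθ => ?_⟩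
  haveI := G.hDprob _ hθ
  haveI := G.hDprob _ h0
  exact glue_set _ _ Et _ (cpl_prod _ _ hR _ _ (G.hDsupp _ h0) (G.hDsupp _ hθ)) 1 one_pos

theorem F_cont (Et : Set (Measure (Euc a × Euc b))) (ε : ℝ) (hε : 0 < ε) :
    ∃ e > 0, ∀ θ ∈ G.D, ∀ θ' ρ, Cpl θ ρ e → Cpl θ' ρ e → W2sqSet θ' Et ≤ W2sqSet θ Et + ε := by
  obtain ⟨C, hC0, hC⟩ := F_bdd G Et
  obtain ⟨l, hl0, hl1, hlC⟩ : ∃ l : ℝ, 0 < l ∧ l ≤ 1 ∧ 3 * l * C ≤ ε / 2 := by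
    refine ⟨min 1 (ε / (6 * (C + 1))), by positivity, min_le_left _ _, ?_⟩
    have h := min_le_right 1 (ε / (6 * (C + 1)))
    rw [le_div_iff₀ (by positivity)] at h
    have h0 : 0 < min 1 (ε / (6 * (C + 1))) := by positivity
    nlinarith
  obtain ⟨e, he0, he⟩ : ∃ e : ℝ, 0 < e ∧ 3 * ((1 + 1 / l) * e) ≤ ε / 2 := by
    refine ⟨ε / 6 / (1 + 1 / l), by positivity, ?_⟩
    rw [mul_div_cancel₀ _ (by positivity)]
    linarith
  refine ⟨e, he0, fun θ hθ θ' ρ h1 h2 => ?_⟩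
  have k1 := glue_set θ ρ Et e h1 l hl0
  have k2 := glue_set ρ θ' Et e h2.symm l hl0
  have k3 := hC θ hθ
  have k4 := W2sqSet_nonneg θ Et
  set A := (1 + 1 / l) * e
  have hA : 0 < A := by positivity
  have k5 : (1 + l) * W2sqSet ρ Et ≤ (1 + l) * ((1 + l) * W2sqSet θ Et + A) := by gcongr
  have k6 : l * l * W2sqSet θ Et ≤ l * W2sqSet θ Et := by
    have : l * W2sqSet θ Et ≥ 0 := by positivity
    nlinarith
  have k7 : l * W2sqSet θ Et ≤ l * C := by gcongr
  have k8 : l * A ≤ A := by nlinarith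
  nlinarith

/-- NADC with explicit `N` -/
def NADCN {Ω₁ Ω₂ : Type*} [MeasurableSpace Ω₁] [MeasurableSpace Ω₂]
    {DZ : Set (Measure Ω₂)} {DX : Set (Measure Ω₁)}
    (s0 : ℝ) (α : MControl DZ → MControl DX) (N : ℕ) : Prop :=
    (∀ z : MControl DZ, ∀ k < N, ∃ c,
      ∀ s ∈ Ico ((k : ℝ) / N) ((k + 1 : ℝ) / N), (α z).1 s = c) ∧
    (∀ k < N, ∀ z z' : MControl DZ, AEEqOn s0 ((k : ℝ) / N) z.1 z'.1 →
      AEEqOn s0 ((k + 1 : ℝ) / N) (α z).1 (α z').1)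

theorem AEEqOn.mono {E : Type*} {s t s' t' : ℝ} {x y : ℝ → E} (h : AEEqOn s t x y) (hs : s ≤ s') (ht : t' ≤ t) :
    AEEqOn s' t' x y := ae_restrict_of_ae_restrict_of_subset (Icc_subset_Icc hs ht) h

theorem NADCN.refine {Ω₁ Ω₂ : Type*} [MeasurableSpace Ω₁] [MeasurableSpace Ω₂]
    {DZ : Set (Measure Ω₂)} {DX : Set (Measure Ω₁)}
    {s0 : ℝ} {α : MControl DZ → MControl DX} {N P : ℕ} (hN : 0 < N) (hP : 0 < P) (h : NADCN s0 α N) :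
    NADCN s0 α (N * P) := by
  have hNr : (0 : ℝ) < N := by exact_mod_cast hN
  have hPr : (0 : ℝ) < P := by exact_mod_cast hP
  have aux : ∀ k < N * P, k / P < N ∧ ((k / P : ℕ) : ℝ) / N ≤ (k : ℝ) / (N * P : ℕ) ∧
      ((k + 1 : ℝ) / (N * P : ℕ)) ≤ ((k / P : ℕ) + 1 : ℝ) / N := by
    intro k hk
    refine ⟨(Nat.div_lt_iff_lt_mul hP).2 hk, ?_, ?_⟩
    · have h1 : ((k / P : ℕ) : ℝ) * P ≤ k := by exact_mod_cast Nat.div_mul_le_self k P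
      push_cast
      rw [div_le_div_iff₀ hNr (by positivity)]
      nlinarith
    · have h1 : k + 1 ≤ (k / P + 1) * P := by
        have := Nat.lt_mul_div_succ k hP
        rw [mul_comm] at this
        exact this
      have h1 : (k : ℝ) + 1 ≤ ((k / P : ℕ) + 1) * P := by exact_mod_cast h1
      push_cast
      rw [div_le_div_iff₀ (by positivity) hNr]
      nlinarith
  refine ⟨fun z k hk => ?_, fun k hk z z' hz => ?_⟩
  · obtain ⟨h1, h2, h3⟩ := aux k hk
    obtain ⟨c, hc⟩ := h.1 z _ h1
    exact ⟨c, fun s hs => hc s ⟨h2.trans hs.1, hs.2.trans_le h3⟩⟩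
  · obtain ⟨h1, h2, h3⟩ := aux k hk
    exact (h.2 _ h1 z z' (hz.mono le_rfl h2)).mono le_rfl h3

/-- concatenation of controls -/
def cat {Ω : Type*} [MeasurableSpace Ω] {DD : Set (Measure Ω)} (τ : ℝ) (z w : MControl DD) : MControl DD :=
  ⟨fun s => if s < τ then z.1 s else w.1 s,
    Measurable.ite measurableSet_Iio z.2.1 w.2.1, fun s => by
      by_cases h : s < τ
      · simp only [h, if_true]; exact z.2.2 s
      · simp only [h, if_false]; exact w.2.2 s⟩

/-- constant control -/
def cst {Ω : Type*} [MeasurableSpace Ω] {DD : Set (Measure Ω)} (z : Measure Ω) (hz : z ∈ DD) : MControl DD :=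
  ⟨fun _ => z, measurable_const, fun _ => hz⟩

theorem bind_congr_on {Ω : Type*} [MeasurableSpace Ω] {S : Set ℝ} {y y' : ℝ → Measure Ω}
    (h : ∀ᵐ s ∂(volume.restrict S), y s = y' s) :
    (volume.restrict S).bind y = (volume.restrict S).bind y' :=
  Measure.bind_congr_right h

theorem flow {t τ : ℝ} (ht : 0 < t) (h : t < τ) (h1 : τ < 1) (μ : Measure (Euc a × Euc b))
    (x : MControl G.DX) (z w : MControl G.DZ) :
    mtraj t μ x.1 (cat τ z w).1 1 = mtraj τ (mtraj t μ x.1 z.1 τ) x.1 w.1 1 := by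
  have hτ : 0 < τ := ht.trans h
  have e1 : volume.restrict (Ioc t 1) = volume.restrict (Ioc t τ) + (volume.restrict (Ioc τ 1) : Measure ℝ) := by
    rw [← Measure.restrict_union (Ioc_disjoint_Ioc_of_le le_rfl) measurableSet_Ioc,
      Ioc_union_Ioc_eq_Ioc h.le h1.le]
  unfold mtraj
  rw [e1, bind_add_left _ _ (mp G x (cat τ z w))]
  have e2 : (volume.restrict (Ioc t τ)).bind (fun s => (x.1 s).prod ((cat τ z w).1 s))
      = (volume.restrict (Ioc t τ)).bind (fun s => (x.1 s).prod (z.1 s)) := by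
    apply bind_congr_on
    have : ∀ᵐ s : ℝ ∂(volume.restrict (Ioc t τ)), s ≠ τ :=
      ae_restrict_of_ae (Measure.ae_ne volume τ)
    filter_upwards [this, ae_restrict_mem measurableSet_Ioc] with s hs hm
    have : s < τ := lt_of_le_of_ne hm.2 hs
    simp [cat, this]
  have e3 : (volume.restrict (Ioc τ 1)).bind (fun s => (x.1 s).prod ((cat τ z w).1 s))
      = (volume.restrict (Ioc τ 1)).bind (fun s => (x.1 s).prod (w.1 s)) := by
    apply bind_congr_on
    filter_upwards [ae_restrict_mem measurableSet_Ioc] with s hm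
    have : ¬ s < τ := not_lt.2 hm.1.le
    simp [cat, this]
  rw [e2, e3]
  simp only [smul_add, smul_smul, div_one, ENNReal.ofReal_one, one_smul]
  rw [← ENNReal.ofReal_mul hτ.le, ← ENNReal.ofReal_mul hτ.le]
  rw [mul_div_cancel₀ _ hτ.ne', mul_div_cancel₀ _ hτ.ne', ENNReal.ofReal_one, one_smul, add_assoc]

theorem mtraj_cpl {τ e : ℝ} (hτ : 0 < τ) (h1 : τ < 1) {θ θ' : Measure (Euc a × Euc b)} (h : Cpl θ θ' e)
    (x : MControl G.DX) (z : MControl G.DZ) :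
    Cpl (mtraj τ θ x.1 z.1 1) (mtraj τ θ' x.1 z.1 1) e := by
  unfold mtraj
  rw [div_one]
  apply h.mix τ hτ.le h1.le
  rw [div_one, ENNReal.ofReal_one, one_smul, Measure.bind_apply MeasurableSet.univ (mp G x z).aemeasurable]
  have := pp G x z
  simp

theorem cst_nadc (s : ℝ) (z : MControl G.DZ) (hz : ∃ c, ∀ s, z.1 s = c) :
    IsNADCM s (fun _ : MControl G.DX => z) :=
  ⟨1, one_pos, fun _ _ _ => hz.imp fun _ h s _ => h s, fun _ _ _ _ _ => Filter.Eventually.of_forall fun _ => rfl⟩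

theorem nadc_ne (s : ℝ) : Nonempty {β : MControl G.DX → MControl G.DZ // IsNADCM s β} :=
  let ⟨z, hz⟩ := G.hDZne
  ⟨⟨fun _ => cst z hz, cst_nadc G s _ ⟨z, fun _ => rfl⟩⟩⟩

theorem ctl_ne : Nonempty (MControl G.DX) :=
  let ⟨z, hz⟩ := G.hDXne
  ⟨cst z hz⟩

theorem inf_bdd (Et : Set (Measure (Euc a × Euc b))) (s : ℝ) (μ : Measure (Euc a × Euc b))
    (β : MControl G.DX → MControl G.DZ) :
    BddBelow (range fun x : MControl G.DX => W2sqSet (mtraj s μ x.1 (β x).1 1) Et) :=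
  ⟨0, by rintro _ ⟨x, rfl⟩; exact W2sqSet_nonneg _ _⟩

theorem le_V (Et : Set (Measure (Euc a × Euc b))) {s : ℝ} (hs : 0 < s) (hs1 : s < 1)
    {μ : Measure (Euc a × Euc b)} (hμ : μ ∈ G.D) (β : MControl G.DX → MControl G.DZ) (hβ : IsNADCM s β) (L : ℝ)
    (hL : ∀ x : MControl G.DX, L ≤ W2sqSet (mtraj s μ x.1 (β x).1 1) Et) : L ≤ WVminus G.DX G.DZ Et s μ := by
  obtain ⟨C, hC0, hC⟩ := F_bdd G Et
  have := ctl_ne G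
  have hb : BddAbove (range fun β : {β : MControl G.DX → MControl G.DZ // IsNADCM s β} =>
      ⨅ x : MControl G.DX, W2sqSet (mtraj s μ x.1 (β.1 x).1 1) Et) := by
    refine ⟨C, ?_⟩
    rintro _ ⟨γ, rfl⟩
    exact (ciInf_le (inf_bdd G Et s μ γ.1) (Classical.arbitrary _)).trans (hC _ (traj_mem G hs hs1 hμ _ _))
  exact (le_ciInf hL).trans (le_ciSup hb ⟨β, hβ⟩)

theorem V_near (Et : Set (Measure (Euc a × Euc b))) (s : ℝ)
    (μ : Measure (Euc a × Euc b)) (L : ℝ) (hL : L < WVminus G.DX G.DZ Et s μ) :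
    ∃ β : MControl G.DX → MControl G.DZ, IsNADCM s β ∧
      ∀ x : MControl G.DX, L ≤ W2sqSet (mtraj s μ x.1 (β x).1 1) Et := by
  have := nadc_ne G s
  obtain ⟨β, hβ⟩ := exists_lt_of_lt_ciSup hL
  exact ⟨β.1, β.2, fun x => hβ.le.trans (ciInf_le (inf_bdd G Et s μ β.1) x)⟩

theorem DPP (Et : Set (Measure (Euc a × Euc b))) {t τ : ℝ} (ht : 0 < t) (h : t < τ) (h1 : τ < 1)
    {m M : ℕ} (hM : 0 < M) (hτ : τ = (m : ℝ) / M) {μ : Measure (Euc a × Euc b)} (hμ : μ ∈ G.D)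
    (z : Measure (Euc b)) (hz : z ∈ G.DZ) (L : ℝ)
    (hL : ∀ x : MControl G.DX, L ≤ WVminus G.DX G.DZ Et τ (mtraj t μ x.1 (cst z hz).1 τ)) :
    L ≤ WVminus G.DX G.DZ Et t μ := by
  classical
  refine le_of_forall_pos_le_add fun ε' hε' => ?_
  obtain ⟨ε, hε, rfl⟩ : ∃ ε, 0 < ε ∧ ε' = 2 * ε := ⟨ε' / 2, by positivity, by ring⟩
  rw [← sub_le_iff_le_add]
  have h0 : 0 < τ := ht.trans h
  obtain ⟨e, he, hF⟩ := F_cont G Et ε hε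
  have hKne : (G.X ×ˢ G.Z).Nonempty := G.hXne.prod G.hZne
  obtain ⟨S, hSf, hS⟩ := net _ (K_compact G) hKne e he
  have hr : ∀ θ : Measure (Euc a × Euc b), ∃ ρ, θ ∈ G.D → ρ ∈ S ∧ Cpl θ ρ e := by
    intro θ
    by_cases hθ : θ ∈ G.D
    · obtain ⟨ρ, h1, h2⟩ := hS θ (G.hDprob _ hθ) (G.hDsupp _ hθ)
      exact ⟨ρ, fun _ => ⟨h1, h2⟩⟩
    · exact ⟨θ, fun h => absurd h hθ⟩
  choose r hr using hr
  let Θ : MControl G.DX → Measure (Euc a × Euc b) := fun x => mtraj t μ x.1 (cst z hz).1 τ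
  have hΘ : ∀ x, Θ x ∈ G.D := fun x => traj_mem G ht h hμ x (cst z hz)
  have hβ : ∀ ρ : Measure (Euc a × Euc b), ∃ (β : MControl G.DX → MControl G.DZ) (N : ℕ), 0 < N ∧ NADCN τ β N ∧
      ∀ x, r (Θ x) = ρ → ∀ x', L - 2 * ε ≤ W2sqSet (mtraj τ (Θ x) x'.1 (β x').1 1) Et := by
    intro ρ
    by_cases hx : ∃ x, r (Θ x) = ρ
    · obtain ⟨x0, hx0⟩ := hx
      obtain ⟨β, ⟨N, hN, hβN⟩, hβ⟩ := V_near G Et τ (Θ x0) (L - ε) (by linarith [hL x0])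
      refine ⟨β, N, hN, hβN, fun x hx x' => ?_⟩
      have c0 := (hr _ (hΘ x0)).2
      have c1 := (hr _ (hΘ x)).2
      rw [hx0] at c0
      rw [hx] at c1
      have := hF _ (traj_mem G h0 h1 (hΘ x) x' (β x')) _ _ (mtraj_cpl G h0 h1 c1 x' (β x'))
        (mtraj_cpl G h0 h1 c0 x' (β x'))
      linarith [hβ x']
    · obtain ⟨N, hN, hb⟩ := cst_nadc G τ (cst z hz) ⟨z, fun _ => rfl⟩
      exact ⟨_, N, hN, hb, fun x hxx => absurd ⟨x, hxx⟩ hx⟩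
  choose β N hN hβN hβ using hβ
  let Q : ℕ := ∏ ρ ∈ hSf.toFinset, N ρ
  have hQ : 0 < Q := Finset.prod_pos fun ρ _ => hN ρ
  have hMQ : 0 < M * Q := Nat.mul_pos hM hQ
  have hall : ∀ ρ ∈ S, NADCN τ (β ρ) (M * Q) := by
    intro ρ hρ
    obtain ⟨P, hP⟩ : N ρ ∣ M * Q := Dvd.dvd.mul_left (Finset.dvd_prod_of_mem N (hSf.mem_toFinset.2 hρ)) M
    have hP0 : 0 < P := by
      rcases Nat.eq_zero_or_pos P with h | h
      · subst h; omega
      · exact h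
    rw [hP]
    exact (hβN ρ).refine (hN ρ) hP0
  have hMr : (0 : ℝ) < M := by exact_mod_cast hM
  have hQr : (0 : ℝ) < Q := by exact_mod_cast hQ
  have hMQr : (0 : ℝ) < (M * Q : ℕ) := by exact_mod_cast hMQ
  have hτ' : τ = ((m * Q : ℕ) : ℝ) / (M * Q : ℕ) := by
    rw [hτ]; push_cast; field_simp
  refine le_V G Et ht (h.trans h1) hμ (fun x => cat τ (cst z hz) (β (r (Θ x)) x)) ⟨M * Q, hMQ, ?_, ?_⟩ _ ?_
  · intro x k hk
    by_cases hkm : k < m * Q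
    · refine ⟨z, fun s hs => ?_⟩
      have : s < τ := by
        refine hs.2.trans_le ?_
        rw [hτ']
        gcongr
        exact_mod_cast hkm
      simp [cat, cst, this]
    · obtain ⟨c, hc⟩ := (hall _ (hr _ (hΘ x)).1).1 x k hk
      refine ⟨c, fun s hs => ?_⟩
      have : ¬ s < τ := by
        rw [not_lt]
        refine le_trans ?_ hs.1
        rw [hτ']
        gcongr
        exact not_lt.1 hkm
      simp only [cat, this, if_false]
      exact hc s hs
  · intro k hk x x' hxx
    by_cases hkm : k < m * Q
    · have : ((k : ℝ) + 1) / (M * Q : ℕ) ≤ τ := by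
        rw [hτ']
        gcongr
        exact_mod_cast hkm
      refine AEEqOn.mono ?_ le_rfl this
      have hne : ∀ᵐ s : ℝ ∂(volume.restrict (Icc t τ)), s ≠ τ :=
        ae_restrict_of_ae (Measure.ae_ne volume τ)
      unfold AEEqOn
      filter_upwards [hne, ae_restrict_mem measurableSet_Icc] with s hs hm
      have : s < τ := lt_of_le_of_ne hm.2 hs
      simp [cat, this]
    · have hk' : τ ≤ (k : ℝ) / (M * Q : ℕ) := by
        rw [hτ']
        gcongr
        exact not_lt.1 hkm
      have hΘe : Θ x = Θ x' := by
        simp only [Θ, mtraj]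
        congr 2
        apply bind_congr_on
        have := ae_restrict_of_ae_restrict_of_subset Ioc_subset_Icc_self (hxx.mono le_rfl hk')
        filter_upwards [this] with s hs
        rw [hs]
      have := (hall _ (hr _ (hΘ x)).1).2 k hk x x' (hxx.mono h.le le_rfl)
      simp only [← hΘe]
      unfold AEEqOn at this ⊢
      rw [ae_restrict_iff' measurableSet_Icc] at this ⊢
      filter_upwards [this] with s hs hm
      by_cases hsτ : s < τ
      · simp [cat, hsτ]
      · simp only [cat, hsτ, if_false]
        exact hs ⟨not_lt.1 hsτ, hm.2⟩
  · intro x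
    rw [flow G ht h h1]
    exact hβ _ x rfl x

end Game

/-- The lower value `V⁻` of the game `Γ_{Ẽ,δ}` is a super-solution of the
Hamilton–Jacobi equation `ω_t + ℋ⁻(t,μ,Dω) = 0` on `(s0,1) × Δ_δ(X×Z)`: for every `(t,μ)`
and every `(p,φ) ∈ D⁻V⁻(t,μ)` one has `p + ℋ⁻(t,μ,φ) ≤ 0`. -/
theorem statement12 {a b : ℕ} (G : DeltaSets a b)
    (pstar : Euc a × Euc b) (hpstar : pstar ∈ G.X ×ˢ G.Z)
    (Et : Set (Measure (Euc a × Euc b)))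
    (hEt : IsClosed {q : ProbabilityMeasure (Euc a × Euc b) | (q : Measure (Euc a × Euc b)) ∈ Et})
    (s0 : ℝ) (hs0 : s0 ∈ Ioo (0 : ℝ) 1) :
    ∀ t ∈ Ioo s0 1, ∀ μ ∈ G.D, ∀ p : ℝ, ∀ φ ∈ Xi (G.X ×ˢ G.Z) pstar,
      InSubDiff s0 G.D (WVminus G.DX G.DZ Et) t μ p φ →
      p + Hminus G.DX G.DZ t μ φ ≤ 0 := by
  intro t htt μ hμ p φ hφ hsub
  have ht : 0 < t := hs0.1.trans htt.1
  have ht1 : t < 1 := htt.2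
  obtain ⟨B, hB⟩ := (K_compact G).exists_bound_of_continuousOn hφ.1
  have hKm : MeasurableSet (G.X ×ˢ G.Z) := (K_compact G).isClosed.measurableSet
  have hB0 : 0 ≤ B := (norm_nonneg _).trans (hB pstar hpstar)
  let φ' : Euc a × Euc b → ℝ := (G.X ×ˢ G.Z).indicator φ
  have hφm : Measurable φ' := by
    classical
    have := hφ.1.measurable_piecewise (g := fun _ => (0 : ℝ)) continuousOn_const hKm
    rwa [show φ' = (G.X ×ˢ G.Z).piecewise φ (fun _ => 0) from (piecewise_eq_indicator).symm]
  have hφB : ∀ w, ‖φ' w‖ ≤ B := by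
    intro w
    by_cases hw : w ∈ G.X ×ˢ G.Z
    · simp only [φ', indicator_of_mem hw]; exact hB w hw
    · simp only [φ', indicator_of_notMem hw, norm_zero]; exact hB0
  have hφe : ∀ θ ∈ G.D, ∫ w, φ w ∂θ = ∫ w, φ' w ∂θ := by
    intro θ hθ
    apply integral_congr_ae
    have : ∀ᵐ w ∂θ, w ∈ G.X ×ˢ G.Z := G.hDsupp θ hθ
    filter_upwards [this] with w hw
    exact (indicator_of_mem hw φ).symm
  have hIB : ∀ θ ∈ G.D, |∫ w, φ w ∂θ| ≤ B := by
    intro θ hθ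
    have := G.hDprob _ hθ
    rw [hφe θ hθ, ← Real.norm_eq_abs]
    simpa using norm_integral_le_of_norm_le_const (μ := θ) (Filter.Eventually.of_forall hφB)
  have hne : Nonempty G.DZ := G.hDZne.to_subtype
  suffices hmain : ∀ z : G.DZ, (⨅ x : G.DX, (1 / t) * ((∫ p, φ p ∂(x.1.prod z.1)) - ∫ p, φ p ∂μ)) ≤ -p by
    have := ciSup_le hmain
    unfold Hminus
    linarith
  rintro ⟨z, hz⟩
  simp only
  set g := (⨅ x : G.DX, (1 / t) * ((∫ p, φ p ∂(x.1.prod z)) - ∫ p, φ p ∂μ)) with hg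
  have hgle : ∀ x ∈ G.DX, t * g + ∫ w, φ w ∂μ ≤ ∫ w, φ w ∂(x.prod z) := by
    intro x hx
    have hbb : BddBelow (range fun x : G.DX => (1 / t) * ((∫ p, φ p ∂(x.1.prod z)) - ∫ p, φ p ∂μ)) := by
      refine ⟨(1 / t) * (-B - B), ?_⟩
      rintro _ ⟨y, rfl⟩
      have k1 := abs_le.1 (hIB _ (G.hDprod _ y.2 _ hz))
      have k2 := abs_le.1 (hIB _ hμ)
      simp only
      gcongr
      · exact k1.1
      · exact k2.2
    have k := ciInf_le hbb ⟨x, hx⟩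
    rw [← hg] at k
    simp only at k
    have k' := mul_le_mul_of_nonneg_left k ht.le
    rw [← mul_assoc, mul_one_div_cancel ht.ne', one_mul] at k'
    linarith
  clear_value g
  by_contra hcon
  obtain ⟨κ, hκ, hκe⟩ : ∃ κ, 0 < κ ∧ κ = p + g := ⟨p + g, by linarith, rfl⟩
  obtain ⟨ε, hε, hεe⟩ : ∃ ε, 0 < ε ∧ ε * (1 / t + 1) = κ / 4 :=
    ⟨κ / 4 / (1 / t + 1), by positivity, by field_simp⟩
  obtain ⟨r, hr, hsub⟩ := hsub ε hε
  obtain ⟨q, hq1, hq2⟩ := exists_rat_btwn (show t < min (min 1 (t + r)) (min (t + r * t) (t + t * κ / (4 * (|g| + 1)))) by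
    have : 0 < r * t := by positivity
    have : 0 < t * κ / (4 * (|g| + 1)) := by positivity
    refine lt_min (lt_min ?_ ?_) (lt_min ?_ ?_) <;> linarith)
  simp only [lt_min_iff] at hq2
  obtain ⟨⟨c1, c2⟩, c3, c4⟩ := hq2
  have hq0 : 0 < q := by exact_mod_cast ht.trans hq1
  have hqe : (q : ℝ) = ((q.num.toNat : ℕ) : ℝ) / (q.den : ℕ) := by
    have e1 : ((q.num.toNat : ℕ) : ℤ) = q.num := Int.toNat_of_nonneg (Rat.num_pos.2 hq0).le
    have e2 : ((q.num.toNat : ℕ) : ℝ) = (q.num : ℝ) := by exact_mod_cast congrArg (Int.cast : ℤ → ℝ) e1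
    rw [e2]
    exact Rat.cast_def q
  generalize hτq : (q : ℝ) = τ at *
  have hτ0 : 0 < τ := ht.trans hq1
  have hh : 0 < τ - t := by linarith
  have hal : (τ - t) / τ < r := by
    rw [div_lt_iff₀ hτ0]
    nlinarith
  have hal0 : 0 < (τ - t) / τ := by positivity
  have key := DPP G Et ht hq1 c1 q.den_pos hqe hμ z hz
    (WVminus G.DX G.DZ Et t μ + p * (τ - t) + (τ - t) / τ * (t * g) - ε * ((τ - t) / τ + (τ - t))) (by
      intro x
      have hD := avg_mem G hq1 x (cst z hz)
      have k := hsub _ ⟨hal0, hal⟩ τ ⟨(htt.1.trans hq1).le, c1.le⟩ (by rw [abs_of_pos hh]; linarith) _ hD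
      rw [← mtraj_eq ht hq1, abs_of_pos hh, integral_neg, integral_neg] at k
      have := nleb_prob hq1
      obtain ⟨i1, i2⟩ := integral_bind_bdd (ν := nleb t τ) (mp G x (cst z hz)) (pp G x (cst z hz)) φ' hφm B hφB
      have i3 : t * g + ∫ w, φ w ∂μ ≤ ∫ w, φ w ∂((nleb t τ).bind (fun s => (x.1 s).prod ((cst z hz).1 s))) := by
        rw [hφe _ hD, i2]
        have : ∫ s, (t * g + ∫ w, φ w ∂μ) ∂(nleb t τ) = t * g + ∫ w, φ w ∂μ := by simp
        rw [← this]
        refine integral_mono (integrable_const _) i1 fun s => ?_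
        have k1 := hgle _ (x.2.2 s)
        rw [hφe _ (G.hDprod _ (x.2.2 s) _ hz)] at k1
        exact k1
      have i4 := mul_le_mul_of_nonneg_left (sub_le_sub_right i3 (∫ w, φ w ∂μ)) hal0.le
      rw [add_sub_cancel_right] at i4
      linarith)
  have key2 : (τ - t) * (p + t / τ * g) ≤ (τ - t) * (ε * (1 / τ + 1)) := by
    have e1 : (τ - t) / τ * (t * g) = (τ - t) * (t / τ * g) := by ring
    have e2 : ε * ((τ - t) / τ + (τ - t)) = (τ - t) * (ε * (1 / τ + 1)) := by ring
    rw [e1, e2] at key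
    linarith
  have key3 := le_of_mul_le_mul_left key2 hh
  have key4 : ε * (1 / τ + 1) ≤ κ / 4 := by
    rw [← hεe]
    gcongr
  have key5 : g - κ / 4 ≤ t / τ * g := by
    have e1 : t / τ * g = g - (τ - t) / τ * g := by field_simp; ring
    have e2 : (τ - t) / τ * g ≤ (τ - t) / t * |g| := by
      calc (τ - t) / τ * g ≤ (τ - t) / τ * |g| := by gcongr; exact le_abs_self g
        _ ≤ _ := by gcongr
    have e3 : (τ - t) / t * |g| ≤ κ / 4 := by
      have c5 : τ - t < t * κ / (4 * (|g| + 1)) := by linarith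
      rw [lt_div_iff₀ (by positivity)] at c5
      rw [div_mul_eq_mul_div, div_le_iff₀ ht]
      nlinarith
    linarith
  linarith
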